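/- Let (G_n, δ_n)_{n∈ℕ} be a sequence of proper metric monoids with identity elements e_n. Suppose that for every n ∈ ℕ there exist ε_n > 0 and a (1/ε_n)-local ε_n-almost isometric isomorphism (ς_n, κ_n) from (G_n,δ_n) to (G_{n+1},δ_{n+1}), such that: (1) Σ_{n=0}^∞ ε_n < ∞, and (2) for all N ∈ ℕ and all g ∈ G_N[1/Σ_{n=N}^∞ ε_n], the sequence ϖ_N(g) = (g_n)_{n∈ℕ} defined by g_n = e_n for n < N, g_N = g, and g_n = ς_{n-1}(g_{n-1}) for n > N, is a regular sequence. Then there exists a proper metric monoid (G, δ) such that lim_{n→∞} Υ((G_n,δ_n),(G,δ)) = 0. -/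

import Mathlib

/-- `(ς, κ)` is an `r`-local `ε`-almost isometric isomorphism between the metric
monoids `G` and `H`. -/
def IsLocAlmostIsoIso {G H : Type*} [Monoid G] [MetricSpace G] [Monoid H] [MetricSpace H]
    (ς : G → H) (κ : H → G) (ε r : ℝ) : Prop :=
  ς 1 = 1 ∧ κ 1 = 1 ∧
    (∀ g ∈ Metric.closedBall (1 : G) r, ∀ g' ∈ Metric.closedBall (1 : G) r,
      ∀ h ∈ Metric.closedBall (1 : H) r,
        |dist (ς g * ς g') h - dist (g * g') (κ h)| ≤ ε) ∧
    (∀ g ∈ Metric.closedBall (1 : H) r, ∀ g' ∈ Metric.closedBall (1 : H) r,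
      ∀ h ∈ Metric.closedBall (1 : G) r,
        |dist (κ g * κ g') h - dist (g * g') (ς h)| ≤ ε)
/-- The Gromov-Hausdorff monoid distance `Υ` between two (proper) metric monoids:
`min {√2/2, inf {ε > 0 : ∃ a (1/ε)-local ε-almost isometric isomorphism}}`. -/
noncomputable def Upsilon (G H : Type*) [Monoid G] [MetricSpace G] [Monoid H]
    [MetricSpace H] : ℝ :=
  sInf ({ε : ℝ | 0 < ε ∧ ∃ (ς : G → H) (κ : H → G), IsLocAlmostIsoIso ς κ ε (1 / ε)} ∪
    {Real.sqrt 2 / 2})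
/-- A sequence through a sequence of metric monoids is bounded when
`sup_n δ_n(e_n, g_n) < ∞`. -/
def BoundedSeq {G : ℕ → Type*} [∀ n, Monoid (G n)] [∀ n, MetricSpace (G n)]
    (g : ∀ n, G n) : Prop :=
  ∃ M : ℝ, ∀ n, dist (1 : G n) (g n) ≤ M

/-- A bounded sequence is regular when the right translations by its terms are
asymptotically uniformly equicontinuous. -/
def RegularSeq {G : ℕ → Type*} [∀ n, Monoid (G n)] [∀ n, MetricSpace (G n)]
    (g : ∀ n, G n) : Prop :=
  BoundedSeq g ∧
    ∀ ε : ℝ, 0 < ε → ∃ ω : ℝ, 0 < ω ∧ ∃ N : ℕ, ∀ n, N ≤ n → ∀ h k : G n,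
      dist h k < ω → dist (h * g n) (k * g n) < ε
/-- Iterated application of the maps `ς` starting at index `N`. -/
def iterMap {G : ℕ → Type*} (ς : ∀ n, G n → G (n + 1)) (N : ℕ) (g : G N) :
    ∀ k : ℕ, G (N + k)
  | 0 => g
  | k + 1 => ς (N + k) (iterMap ς N g k)

/-- The sequence `ϖ_N(g)`: identity before index `N`, `g` at index `N`, and then the
successive images of `g` under the maps `ς`. -/
def varpi {G : ℕ → Type*} [∀ n, Monoid (G n)] (ς : ∀ n, G n → G (n + 1)) (N : ℕ)
    (g : G N) (n : ℕ) : G n :=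
  if h : N ≤ n then cast (congrArg G (Nat.add_sub_cancel' h)) (iterMap ς N g (n - N))
  else 1

open Filter Topology

namespace IsLocAlmostIsoIso

variable {G H : Type*} [Monoid G] [MetricSpace G] [Monoid H] [MetricSpace H]
  {ς : G → H} {κ : H → G} {ε r : ℝ}

theorem symm (h : IsLocAlmostIsoIso ς κ ε r) : IsLocAlmostIsoIso κ ς ε r :=
  ⟨h.2.1, h.1, h.2.2.2, h.2.2.1⟩

theorem abs_dist_map_sub_le (h : IsLocAlmostIsoIso ς κ ε r) {a : G} {b : H}
    (ha : dist 1 a ≤ r) (hb : dist 1 b ≤ r) :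
    |dist (ς a) b - dist a (κ b)| ≤ ε := by
  have hr : 0 ≤ r := dist_nonneg.trans ha
  have := h.2.2.1 a (by simpa [dist_comm] using ha) 1 (by simpa using hr) b
    (by simpa [dist_comm] using hb)
  simpa [h.1] using this

theorem dist_one_map_le (h : IsLocAlmostIsoIso ς κ ε r) {a : G} (ha : dist 1 a ≤ r) :
    dist 1 (ς a) ≤ dist 1 a + ε := by
  have := h.abs_dist_map_sub_le ha (b := 1) (by simpa using dist_nonneg.trans ha)
  rw [h.2.1, abs_le] at this
  rw [dist_comm 1, dist_comm 1]
  linarith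

theorem abs_dist_map_mul_map_sub_le (h : IsLocAlmostIsoIso ς κ ε r) {a b c : G}
    (ha : dist 1 a ≤ r) (hb : dist 1 b ≤ r) (hc : dist 1 c ≤ r) (hc' : dist 1 (ς c) ≤ r) :
    |dist (ς a * ς b) (ς c) - dist (a * b) c| ≤ 2 * ε := by
  have h₁ := h.2.2.1 a (by simpa [dist_comm] using ha) b (by simpa [dist_comm] using hb) (ς c)
    (by simpa [dist_comm] using hc')
  have h₂ := h.abs_dist_map_sub_le hc hc'
  have h₃ := abs_dist_sub_le (κ (ς c)) c (a * b)
  rw [dist_self, zero_sub, abs_neg, abs_of_nonneg dist_nonneg, dist_comm] at h₂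
  rw [dist_comm _ (a * b), dist_comm _ (a * b)] at h₃
  rw [abs_le] at *
  constructor <;> linarith [h₁.1, h₁.2, h₃.1, h₃.2]

end IsLocAlmostIsoIso

/-- A map that is almost multiplicative, almost isometric and has almost dense range, into a monoid
whose right translations are locally equicontinuous, is half of a local almost isometric
isomorphism. -/
theorem exists_isLocAlmostIsoIso_of_almost_dense {G H : Type*} [Monoid G] [MetricSpace G]
    [Monoid H] [MetricSpace H] [IsIsometricSMul H H] {f : G → H} {η τ R : ℝ}
    (hη : 4 * τ ≤ η) (hτ : τ ≤ 1) (hτ₀ : 0 ≤ τ) (f_one : f 1 = 1)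
    (f_mul : ∀ a b c : G, dist 1 a ≤ R + 1 → dist 1 b ≤ R + 1 → dist 1 c ≤ R + 1 →
      |dist (f a * f b) (f c) - dist (a * b) c| ≤ τ)
    (f_dense : ∀ z : H, dist 1 z ≤ R → ∃ a : G, dist 1 a ≤ R + 1 ∧ dist (f a) z ≤ τ)
    (equi : ∀ a b c : H, dist 1 a ≤ R + 1 → dist 1 b ≤ R + 1 → dist 1 c ≤ R + 1 →
      dist a b ≤ τ → dist (a * c) (b * c) ≤ η / 4) :
    ∃ κ : H → G, IsLocAlmostIsoIso f κ η R := by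
  have key : ∀ z : H, ∃ a : G, (z = 1 → a = 1) ∧
      (dist 1 z ≤ R → dist 1 a ≤ R + 1 ∧ dist (f a) z ≤ τ) := by
    intro z
    by_cases hz : z = 1
    · subst hz
      refine ⟨1, fun _ => rfl, fun h => ?_⟩
      rw [dist_self] at h
      simp only [f_one, dist_self]
      exact ⟨by linarith, hτ₀⟩
    · by_cases hR : dist 1 z ≤ R
      · obtain ⟨a, ha⟩ := f_dense z hR
        exact ⟨a, fun h => absurd h hz, fun _ => ha⟩
      · exact ⟨1, fun _ => rfl, fun h => absurd h hR⟩
  choose κ κ_one hκ using key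
  refine ⟨κ, f_one, κ_one 1 rfl, ?_, ?_⟩
  · intro g hg g' hg' h hh
    rw [Metric.mem_closedBall, dist_comm] at hg hg' hh
    obtain ⟨h₁, h₂⟩ := hκ h hh
    have h₃ := f_mul g g' (κ h) (by linarith) (by linarith) h₁
    have h₄ := abs_dist_sub_le (f (κ h)) h (f g * f g')
    rw [dist_comm _ (f g * f g'), dist_comm _ (f g * f g')] at h₄
    rw [abs_le] at *
    constructor <;> linarith [h₃.1, h₃.2, h₄.1, h₄.2]
  · intro g hg g' hg' h hh
    rw [Metric.mem_closedBall, dist_comm] at hg hg' hh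
    obtain ⟨h₁, h₂⟩ := hκ g hg
    obtain ⟨h₁', h₂'⟩ := hκ g' hg'
    have h₃ := f_mul (κ g) (κ g') h h₁ h₁' (by linarith)
    have h₄ := abs_dist_sub_le (f (κ g) * f (κ g')) (g * g') (f h)
    have h₅ := equi (f (κ g)) g (f (κ g'))
      (by linarith [dist_triangle 1 g (f (κ g)), dist_comm g (f (κ g))]) (by linarith)
      (by linarith [dist_triangle 1 g' (f (κ g')), dist_comm g' (f (κ g'))]) h₂
    have h₆ : dist (g * f (κ g')) (g * g') ≤ τ := by rwa [dist_mul_left]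
    have h₇ := dist_triangle (f (κ g) * f (κ g')) (g * f (κ g')) (g * g')
    rw [abs_le] at *
    constructor <;> linarith [h₃.1, h₃.2, h₄.1, h₄.2]

/-- Right translations by elements of a bounded set are uniformly equicontinuous on bounded sets
in a proper metric monoid. -/
theorem exists_dist_mul_right_lt {H : Type*} [Monoid H] [PseudoMetricSpace H] [ContinuousMul H]
    [ProperSpace H] (R : ℝ) {η : ℝ} (hη : 0 < η) :
    ∃ ω > 0, ∀ a b c : H, dist 1 a ≤ R → dist 1 b ≤ R → dist 1 c ≤ R →
      dist a b < ω → dist (a * c) (b * c) < η := by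
  have hK : IsCompact (Metric.closedBall (1 : H) R ×ˢ Metric.closedBall (1 : H) R) :=
    (isCompact_closedBall _ _).prod (isCompact_closedBall _ _)
  have hu := hK.uniformContinuousOn_of_continuous
    (f := fun p : H × H => p.1 * p.2) continuous_mul.continuousOn
  obtain ⟨ω, hω, h⟩ := Metric.uniformContinuousOn_iff.1 hu η hη
  refine ⟨ω, hω, fun a b c ha hb hc hab => ?_⟩
  simp only [dist_comm (1 : H)] at ha hb hc
  exact h (a, c) ⟨ha, hc⟩ (b, c) ⟨hb, hc⟩ (by
    rw [Prod.dist_eq]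
    simpa using hab)

instance {X : Type*} [PseudoMetricSpace X] [ProperSpace X] :
    ProperSpace (SeparationQuotient X) := by
  refine ⟨fun z r => ?_⟩
  obtain ⟨x, rfl⟩ := SeparationQuotient.surjective_mk z
  have himage : Metric.closedBall (SeparationQuotient.mk x) r =
      SeparationQuotient.mk '' Metric.closedBall x r := by
    ext w
    obtain ⟨y, rfl⟩ := SeparationQuotient.surjective_mk w
    refine ⟨fun hy => ⟨y, hy, rfl⟩, ?_⟩
    rintro ⟨y', hy', hyy'⟩
    rw [← hyy']
    exact hy'
  rw [himage]
  exact (isCompact_closedBall x r).image SeparationQuotient.continuous_mk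

instance {X : Type*} [PseudoMetricSpace X] [Monoid X] [ContinuousMul X] [IsIsometricSMul X X] :
    IsIsometricSMul (SeparationQuotient X) (SeparationQuotient X) := by
  refine ⟨fun g => Isometry.of_dist_eq fun x y => ?_⟩
  obtain ⟨g, rfl⟩ := SeparationQuotient.surjective_mk g
  obtain ⟨x, rfl⟩ := SeparationQuotient.surjective_mk x
  obtain ⟨y, rfl⟩ := SeparationQuotient.surjective_mk y
  exact dist_mul_left g x y

theorem Upsilon_nonneg (G H : Type*) [Monoid G] [MetricSpace G] [Monoid H] [MetricSpace H] :
    0 ≤ Upsilon G H := by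
  refine Real.sInf_nonneg ?_
  rintro x (hx | rfl)
  · exact hx.1.le
  · positivity

theorem Upsilon_le {G H : Type*} [Monoid G] [MetricSpace G] [Monoid H] [MetricSpace H]
    {ς : G → H} {κ : H → G} {ε : ℝ} (hε : 0 < ε) (h : IsLocAlmostIsoIso ς κ ε (1 / ε)) :
    Upsilon G H ≤ ε := by
  refine csInf_le ⟨0, ?_⟩ (Or.inl ⟨hε, ς, κ, h⟩)
  rintro x (hx | rfl)
  · exact hx.1.le
  · positivity

section Varpi

variable {G : ℕ → Type*} [∀ n, Monoid (G n)] (ς : ∀ n, G n → G (n + 1)) (N : ℕ)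

theorem varpi_add (g : G N) (k : ℕ) : varpi ς N g (N + k) = iterMap ς N g k := by
  rw [varpi, dif_pos (Nat.le_add_right N k), cast_eq_iff_heq, Nat.add_sub_cancel_left]

theorem varpi_self (g : G N) : varpi ς N g N = g := varpi_add ς N g 0

variable {N}

theorem varpi_succ (g : G N) {n : ℕ} (hn : N ≤ n) :
    varpi ς N g (n + 1) = ς n (varpi ς N g n) := by
  obtain ⟨k, rfl⟩ := Nat.exists_eq_add_of_le hn
  rw [varpi_add]
  exact varpi_add ς N g (k + 1)

theorem varpi_one (h : ∀ n, ς n 1 = 1) (n : ℕ) : varpi ς N 1 n = 1 := by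
  by_cases hn : N ≤ n
  · induction n, hn using Nat.le_induction with
    | base => exact varpi_self ς N 1
    | succ n hn ih => rw [varpi_succ ς 1 hn, ih, h]
  · exact dif_neg hn

end Varpi

theorem eventually_hyperfilter_ge (N : ℕ) : ∀ᶠ n in hyperfilter ℕ, N ≤ n :=
  Nat.hyperfilter_le_atTop (eventually_ge_atTop N)

/-- The bounded sequences through a sequence of metric monoids. -/
def BoundedSeqs (G : ℕ → Type*) [∀ n, Monoid (G n)] [∀ n, MetricSpace (G n)] : Type _ :=
  {x : ∀ n, G n // BoundedSeq x}

namespace BoundedSeqs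

variable {G : ℕ → Type*} [∀ n, Monoid (G n)] [∀ n, MetricSpace (G n)]

instance : CoeFun (BoundedSeqs G) fun _ => ∀ n, G n := ⟨Subtype.val⟩

theorem exists_tendsto_dist (x y : BoundedSeqs G) :
    ∃ d : ℝ, Tendsto (fun n => dist (x n) (y n)) (hyperfilter ℕ) (𝓝 d) := by
  obtain ⟨M, hM⟩ := x.2
  obtain ⟨M', hM'⟩ := y.2
  obtain ⟨d, -, hd⟩ := (isCompact_Icc (a := (0 : ℝ)) (b := M + M')).ultrafilter_le_nhds
    ((hyperfilter ℕ).map fun n => dist (x n) (y n)) (by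
      rw [le_principal_iff]
      refine mem_map.2 (Eventually.of_forall fun n => ?_)
      refine ⟨dist_nonneg (x := x n) (y := y n), ?_⟩
      exact (dist_triangle_left _ _ 1).trans (add_le_add (hM n) (hM' n)))
  exact ⟨d, hd⟩

/-- The distance between bounded sequences is the limit of the distances between their terms along
a fixed nonprincipal ultrafilter. -/
noncomputable instance : Dist (BoundedSeqs G) :=
  ⟨fun x y => limUnder (hyperfilter ℕ : Filter ℕ) fun n => dist (x n) (y n)⟩

theorem tendsto_dist (x y : BoundedSeqs G) :
    Tendsto (fun n => dist (x n) (y n)) (hyperfilter ℕ) (𝓝 (dist x y)) :=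
  tendsto_nhds_limUnder (exists_tendsto_dist x y)

noncomputable instance : PseudoMetricSpace (BoundedSeqs G) where
  dist_self x := tendsto_nhds_unique (tendsto_dist x x) (by simp)
  dist_comm x y := tendsto_nhds_unique (tendsto_dist x y) (by
    simpa only [dist_comm] using tendsto_dist y x)
  dist_triangle x y z := le_of_tendsto_of_tendsto' (tendsto_dist x z)
    ((tendsto_dist x y).add (tendsto_dist y z)) fun n => dist_triangle _ _ _

theorem eventually_dist_lt {x y : BoundedSeqs G} {r : ℝ} (h : dist x y < r) :
    ∀ᶠ n in hyperfilter ℕ, dist (x n) (y n) < r :=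
  (tendsto_dist x y).eventually_lt_const h

theorem dist_le {x y : BoundedSeqs G} {r : ℝ}
    (h : ∀ᶠ n in hyperfilter ℕ, dist (x n) (y n) ≤ r) : dist x y ≤ r :=
  le_of_tendsto (tendsto_dist x y) h

theorem dist_le_two_mul_geometric {α : Type*} [PseudoMetricSpace α] {a : ℕ → α} {j m : ℕ}
    (hjm : j ≤ m) (h : ∀ i < m, dist (a i) (a (i + 1)) < (1 / 2) ^ i) :
    dist (a j) (a m) ≤ 2 * (1 / 2) ^ j := by
  suffices dist (a j) (a m) ≤ 2 * (1 / 2) ^ j - 2 * (1 / 2) ^ m from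
    this.trans (sub_le_self _ (by positivity))
  induction m, hjm using Nat.le_induction with
  | base => simp
  | succ m hjm ih =>
    have h₁ := ih fun i hi => h i (by lia)
    have h₂ := h m (by lia)
    have h₃ := dist_triangle (a j) (a m) (a (m + 1))
    rw [pow_succ]
    linarith

instance : CompleteSpace (BoundedSeqs G) := by
  classical
  refine Metric.complete_of_convergent_controlled_sequences (fun n => (1 / 2 : ℝ) ^ n)
    (fun n => by positivity) fun u hu => ?_
  let P (n j : ℕ) : Prop := ∀ i < j, dist (u i n) (u (i + 1) n) < (1 / 2 : ℝ) ^ i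
  let J (n : ℕ) : ℕ := Nat.findGreatest (P n) n
  have hJ : ∀ n, P n (J n) := fun n =>
    Nat.findGreatest_spec (P := P n) (Nat.zero_le n) fun i hi => absurd hi (Nat.not_lt_zero i)
  have hz : ∀ n j, j ≤ J n → dist (u j n) (u (J n) n) ≤ 2 * (1 / 2) ^ j := fun n j hj =>
    dist_le_two_mul_geometric (a := fun i => u i n) hj (hJ n)
  have hbdd : BoundedSeq fun n => u (J n) n := by
    obtain ⟨M, hM⟩ := (u 0).2
    refine ⟨M + 2, fun n => (dist_triangle _ (u 0 n) _).trans (add_le_add (hM n) ?_)⟩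
    simpa using hz n 0 (Nat.zero_le _)
  let z : BoundedSeqs G := ⟨_, hbdd⟩
  refine ⟨z, tendsto_iff_dist_tendsto_zero.2 ?_⟩
  have hlim : Tendsto (fun j : ℕ => 2 * (1 / 2 : ℝ) ^ j) atTop (𝓝 0) := by
    simpa using (tendsto_pow_atTop_nhds_zero_of_lt_one (r := (1 / 2 : ℝ)) (by norm_num)
      (by norm_num)).const_mul 2
  refine squeeze_zero (fun _ => dist_nonneg) (fun j => dist_le ?_) hlim
  have hP : ∀ᶠ n in hyperfilter ℕ, P n j := by
    refine (Set.finite_Iio j).eventually_all.2 fun i _ => ?_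
    exact eventually_dist_lt (hu i i (i + 1) le_rfl (Nat.le_succ i))
  filter_upwards [hP, eventually_hyperfilter_ge j] with n hn hjn
  exact hz n j (Nat.le_findGreatest hjn hn)

variable [∀ n, IsIsometricSMul (G n) (G n)]

instance : Monoid (BoundedSeqs G) :=
  inferInstanceAs (Monoid ({
    carrier := {x | BoundedSeq x}
    one_mem' := ⟨0, fun n => by simp⟩
    mul_mem' := by
      rintro x y ⟨M, hM⟩ ⟨M', hM'⟩
      refine ⟨M + M', fun n => (dist_triangle _ (x n) _).trans (add_le_add (hM n) ?_)⟩
      simpa using (dist_mul_left (x n) 1 (y n)).trans_le (hM' n) } : Submonoid (∀ n, G n)))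

theorem one_apply (n : ℕ) : (1 : BoundedSeqs G) n = 1 := rfl

theorem mul_apply (x y : BoundedSeqs G) (n : ℕ) : (x * y) n = x n * y n := rfl

instance : IsIsometricSMul (BoundedSeqs G) (BoundedSeqs G) :=
  ⟨fun g => Isometry.of_dist_eq fun x y => tendsto_nhds_unique (tendsto_dist (g * x) (g * y))
    (by simpa only [mul_apply, dist_mul_left] using tendsto_dist x y)⟩

/-- If right translations by each bounded sequence are asymptotically uniformly equicontinuous, then
multiplication of bounded sequences is jointly continuous. -/
theorem continuousMul_of_equicontinuous
    (h : ∀ y : BoundedSeqs G, ∀ η > 0, ∃ ω > 0, ∀ᶠ n in hyperfilter ℕ, ∀ a b : G n,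
      dist a b < ω → dist (a * y n) (b * y n) < η) :
    ContinuousMul (BoundedSeqs G) := by
  refine ⟨Metric.continuous_iff.2 ?_⟩
  rintro ⟨x, y⟩ η hη
  obtain ⟨ω, hω, hy⟩ := h y (η / 3) (by positivity)
  refine ⟨min ω (η / 3), by positivity, ?_⟩
  rintro ⟨x', y'⟩ hxy
  rw [Prod.dist_eq, max_lt_iff, lt_min_iff, lt_min_iff] at hxy
  have h₁ : dist (x' * y) (x * y) ≤ η / 3 := by
    refine dist_le ?_
    filter_upwards [hy, eventually_dist_lt hxy.1.1] with n hn hn'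
    exact (hn _ _ hn').le
  have h₂ : dist (x' * y') (x' * y) < η / 3 := by
    rw [dist_mul_left]
    exact hxy.2.2
  exact (dist_triangle _ (x' * y) _).trans_lt (by linarith)

end BoundedSeqs

open Classical in
/-- The sequence `varpi ς N g` as a bounded sequence, with value `1` when it is not bounded. -/
noncomputable def boundedVarpi {G : ℕ → Type*} [∀ n, Monoid (G n)] [∀ n, MetricSpace (G n)]
    [∀ n, IsIsometricSMul (G n) (G n)] (ς : ∀ n, G n → G (n + 1)) (N : ℕ) (g : G N) :
    BoundedSeqs G :=
  if hg : BoundedSeq (varpi ς N g) then ⟨varpi ς N g, hg⟩ else 1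

/-- A sequence of metric monoids linked by local almost isometric isomorphisms with defects `ε`,
whose tail sums are `s`, such that images of elements along the sequence are regular. -/
structure IsRegularTower {G : ℕ → Type*} [∀ n, Monoid (G n)] [∀ n, MetricSpace (G n)]
    (ς : ∀ n, G n → G (n + 1)) (κ : ∀ n, G (n + 1) → G n) (ε s : ℕ → ℝ) : Prop where
  pos : ∀ n, 0 < ε n
  iso : ∀ n, IsLocAlmostIsoIso (ς n) (κ n) (ε n) (1 / ε n)
  tail_pos : ∀ n, 0 < s n
  tail_eq : ∀ n, s n = ε n + s (n + 1)
  tail_tendsto : Tendsto s atTop (𝓝 0)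
  regular : ∀ N, ∀ g : G N, dist 1 g ≤ 1 / s N → RegularSeq (varpi ς N g)

namespace IsRegularTower

variable {G : ℕ → Type*} [∀ n, Monoid (G n)] [∀ n, MetricSpace (G n)]
  {ς : ∀ n, G n → G (n + 1)} {κ : ∀ n, G (n + 1) → G n} {ε s : ℕ → ℝ} {N n : ℕ}

theorem tail_antitone (h : IsRegularTower ς κ ε s) : Antitone s :=
  antitone_nat_of_succ_le fun n => by linarith [h.pos n, h.tail_eq n]

theorem one_div_tail_le (h : IsRegularTower ς κ ε s) (hn : N ≤ n) : 1 / s N ≤ 1 / ε n :=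
  one_div_le_one_div_of_le (h.pos n)
    (by linarith [h.tail_antitone hn, h.tail_eq n, h.tail_pos (n + 1)])

theorem eventually_add_tail_le (h : IsRegularTower ς κ ε s) (R : ℝ) :
    ∀ᶠ N in atTop, R + 3 * s N ≤ 1 / s N := by
  have h₁ : Tendsto (fun N => s N * (R + 3 * s N)) atTop (𝓝 (0 * (R + 3 * 0))) :=
    h.tail_tendsto.mul (tendsto_const_nhds.add (h.tail_tendsto.const_mul 3))
  rw [zero_mul] at h₁
  filter_upwards [h₁.eventually_le_const one_pos] with N hN
  rwa [le_div_iff₀ (h.tail_pos N), mul_comm]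

theorem dist_one_varpi_le (h : IsRegularTower ς κ ε s) {g : G N}
    (hg : dist 1 g + s N ≤ 1 / s N) (hn : N ≤ n) :
    dist 1 (varpi ς N g n) ≤ dist 1 g + (s N - s n) := by
  induction n, hn using Nat.le_induction with
  | base => simp [varpi_self]
  | succ n hn ih =>
    have h₁ := h.one_div_tail_le hn
    have h₂ := (h.iso n).dist_one_map_le (a := varpi ς N g n) (by linarith [h.tail_pos n])
    rw [varpi_succ ς g hn]
    linarith [h.tail_eq n]

theorem abs_dist_varpi_mul_varpi_sub_le (h : IsRegularTower ς κ ε s) {a b c : G N} {R : ℝ}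
    (hR : R + s N ≤ 1 / s N) (ha : dist 1 a ≤ R) (hb : dist 1 b ≤ R) (hc : dist 1 c ≤ R)
    (hn : N ≤ n) :
    |dist (varpi ς N a n * varpi ς N b n) (varpi ς N c n) - dist (a * b) c| ≤
      2 * (s N - s n) := by
  have hle : ∀ {g : G N} {m n : ℕ}, dist 1 g ≤ R → N ≤ m → N ≤ n →
      dist 1 (varpi ς N g m) ≤ 1 / ε n := fun {g m n} hg hm hn => by
    linarith [h.dist_one_varpi_le (g := g) (by linarith) hm, h.tail_pos m, h.one_div_tail_le hn]
  induction n, hn using Nat.le_induction with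
  | base => simp [varpi_self]
  | succ n hn ih =>
    have h₁ := (h.iso n).abs_dist_map_mul_map_sub_le (hle ha hn hn) (hle hb hn hn) (hle hc hn hn)
      (varpi_succ ς c hn ▸ hle hc (hn.trans n.le_succ) hn)
    simp only [varpi_succ ς _ hn]
    have h₂ := h.tail_eq n
    rw [abs_le] at *
    constructor <;> linarith [h₁.1, h₁.2, ih.1, ih.2]

theorem exists_dist_varpi_le (h : IsRegularTower ς κ ε s) (hn : N ≤ n) (y : G n)
    (hy : dist 1 y + 2 * (s N - s n) + s n ≤ 1 / s N) :
    ∃ g : G N, dist 1 g ≤ dist 1 y + (s N - s n) ∧ dist (varpi ς N g n) y ≤ s N - s n := by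
  induction n, hn using Nat.le_induction with
  | base => exact ⟨y, by simp [varpi_self]⟩
  | succ n hn ih =>
    have h₁ := h.one_div_tail_le hn
    have h₂ := h.tail_antitone hn
    have h₃ := h.tail_eq n
    have h₄ := h.pos n
    have h₅ := h.tail_pos (n + 1)
    have hy' : dist 1 y ≤ 1 / ε n := by linarith
    have h₆ := (h.iso n).symm.dist_one_map_le hy'
    obtain ⟨g, hg, hgy⟩ := ih (κ n y) (by linarith)
    have h₇ := h.dist_one_varpi_le (g := g) (by linarith) hn
    have h₈ := (h.iso n).abs_dist_map_sub_le (a := varpi ς N g n) (by linarith) hy'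
    rw [abs_le] at h₈
    refine ⟨g, by linarith, ?_⟩
    rw [varpi_succ ς g hn]
    linarith

variable [∀ n, IsIsometricSMul (G n) (G n)]

theorem boundedVarpi_apply (h : IsRegularTower ς κ ε s) {g : G N} (hg : dist 1 g ≤ 1 / s N)
    (n : ℕ) : boundedVarpi ς N g n = varpi ς N g n :=
  congrFun (congrArg Subtype.val (dif_pos (h.regular N g hg).1)) n

theorem boundedVarpi_one (h : IsRegularTower ς κ ε s) : boundedVarpi ς N 1 = 1 := by
  refine Subtype.ext (funext fun n => ?_)
  rw [h.boundedVarpi_apply (by simpa using (h.tail_pos N).le),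
    varpi_one ς fun n => (h.iso n).1]
  rfl

theorem abs_dist_boundedVarpi_mul_sub_le (h : IsRegularTower ς κ ε s) {a b c : G N} {R : ℝ}
    (hR : R + s N ≤ 1 / s N) (ha : dist 1 a ≤ R) (hb : dist 1 b ≤ R) (hc : dist 1 c ≤ R) :
    |dist (boundedVarpi ς N a * boundedVarpi ς N b) (boundedVarpi ς N c) - dist (a * b) c| ≤
      2 * s N := by
  have hs := h.tail_pos N
  refine le_of_tendsto ((BoundedSeqs.tendsto_dist _ _).sub_const _).abs ?_
  filter_upwards [eventually_hyperfilter_ge N] with n hn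
  rw [BoundedSeqs.mul_apply, h.boundedVarpi_apply (by linarith), h.boundedVarpi_apply (by linarith),
    h.boundedVarpi_apply (by linarith)]
  linarith [h.abs_dist_varpi_mul_varpi_sub_le hR ha hb hc hn, h.tail_pos n]

variable [∀ n, ProperSpace (G n)]

theorem exists_dist_boundedVarpi_le (h : IsRegularTower ς κ ε s) {x : BoundedSeqs G} {R : ℝ}
    (hR : R + 3 * s N ≤ 1 / s N) (hx : dist 1 x ≤ R) :
    ∃ g : G N, dist 1 g ≤ R + 2 * s N ∧ dist (boundedVarpi ς N g) x ≤ 3 * s N := by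
  have hs := h.tail_pos N
  have hev : ∀ᶠ n in hyperfilter ℕ, ∃ g : G N, N ≤ n ∧ dist 1 g ≤ R + 2 * s N ∧
      dist (varpi ς N g n) (x n) ≤ s N := by
    filter_upwards [eventually_hyperfilter_ge N,
      BoundedSeqs.eventually_dist_lt (hx.trans_lt (lt_add_of_pos_right R hs))] with n hn hxn
    rw [BoundedSeqs.one_apply] at hxn
    have hsn := h.tail_pos n
    obtain ⟨g, hg, hgx⟩ := h.exists_dist_varpi_le hn (x n) (by linarith)
    exact ⟨g, hn, by linarith, by linarith⟩
  obtain ⟨γ, hγ⟩ := hev.choice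
  obtain ⟨g, hg, hlim⟩ := (isCompact_closedBall (1 : G N) (R + 2 * s N)).ultrafilter_le_nhds
    ((hyperfilter ℕ).map γ) (by
      rw [le_principal_iff]
      exact hγ.mono fun n hn => by simpa [dist_comm] using hn.2.1)
  rw [Metric.mem_closedBall, dist_comm] at hg
  refine ⟨g, hg, ?_⟩
  have htend : Tendsto (fun n => dist g (γ n) + 3 * s N) (hyperfilter ℕ) (𝓝 (0 + 3 * s N)) := by
    refine Tendsto.add_const _ ?_
    simpa using (tendsto_const_nhds (x := g)).dist (show Tendsto γ (hyperfilter ℕ) (𝓝 g) from hlim)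
  rw [zero_add] at htend
  refine le_of_tendsto_of_tendsto (BoundedSeqs.tendsto_dist _ _) htend ?_
  filter_upwards [hγ] with n ⟨hn, hγ₁, hγ₂⟩
  have h₁ := h.abs_dist_varpi_mul_varpi_sub_le (a := g) (b := 1) (c := γ n) (R := R + 2 * s N)
    (by linarith) hg (by simpa using dist_nonneg.trans hg) hγ₁ hn
  rw [varpi_one ς fun n => (h.iso n).1, mul_one, mul_one, abs_le] at h₁
  rw [h.boundedVarpi_apply (by linarith)]
  linarith [h₁.2, dist_triangle (varpi ς N g n) (varpi ς N (γ n) n) (x n), h.tail_pos n]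

theorem continuousMul_boundedSeqs (h : IsRegularTower ς κ ε s) :
    ContinuousMul (BoundedSeqs G) := by
  refine BoundedSeqs.continuousMul_of_equicontinuous fun y η hη => ?_
  obtain ⟨N, hN, hη'⟩ := ((h.eventually_add_tail_le (dist 1 y)).and
    (h.tail_tendsto.eventually_lt_const (show 0 < η / 9 by positivity))).exists
  obtain ⟨g, hg, hgy⟩ := h.exists_dist_boundedVarpi_le hN le_rfl
  have hg' : dist 1 g ≤ 1 / s N := by linarith [h.tail_pos N]
  obtain ⟨ω, hω, M, hM⟩ := (h.regular N g hg').2 (η / 3) (by positivity)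
  refine ⟨ω, hω, ?_⟩
  filter_upwards [eventually_hyperfilter_ge M,
    BoundedSeqs.eventually_dist_lt (hgy.trans_lt (show 3 * s N < η / 3 by linarith))]
    with n hn hgn a b hab
  rw [h.boundedVarpi_apply hg'] at hgn
  have h₁ := hM n hn a b hab
  have h₂ := dist_mul_left a (varpi ς N g n) (y n)
  have h₃ := dist_mul_left b (varpi ς N g n) (y n)
  have h₄ := dist_triangle4 (a * y n) (a * varpi ς N g n) (b * varpi ς N g n) (b * y n)
  rw [dist_comm (a * y n) (a * varpi ς N g n)] at h₄
  linarith

theorem totallyBounded_closedBall (h : IsRegularTower ς κ ε s) (R : ℝ) :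
    TotallyBounded (Metric.closedBall (1 : BoundedSeqs G) R) := by
  refine Metric.totallyBounded_iff.2 fun η hη => ?_
  obtain ⟨N, hN, hη', hs₁⟩ := ((h.eventually_add_tail_le (R + 2)).and
    ((h.tail_tendsto.eventually_lt_const (show 0 < η / 10 by positivity)).and
    (h.tail_tendsto.eventually_lt_const one_pos))).exists
  have hs := h.tail_pos N
  obtain ⟨t, htR, ht, hcover⟩ := finite_cover_balls_of_compact
    (isCompact_closedBall (1 : G N) (R + 2)) (show 0 < η / 2 by positivity)
  refine ⟨boundedVarpi ς N '' t, ht.image _, fun x hx => ?_⟩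
  rw [Metric.mem_closedBall, dist_comm] at hx
  obtain ⟨g, hg, hgx⟩ := h.exists_dist_boundedVarpi_le (by linarith) hx
  have hg' : dist 1 g ≤ R + 2 := by linarith
  obtain ⟨p, hp, hgp⟩ := Set.mem_iUnion₂.1 (hcover (show g ∈ Metric.closedBall 1 (R + 2) by
    rwa [Metric.mem_closedBall, dist_comm]))
  have hp' := htR hp
  rw [Metric.mem_closedBall, dist_comm] at hp'
  refine Set.mem_biUnion (Set.mem_image_of_mem _ hp) ?_
  have h₁ := h.abs_dist_boundedVarpi_mul_sub_le (b := 1) (R := R + 2) (by linarith) hg'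
    (by simpa using dist_nonneg.trans hg') hp'
  rw [h.boundedVarpi_one, mul_one, mul_one, abs_le] at h₁
  rw [Metric.mem_ball] at hgp ⊢
  linarith [dist_triangle_left x (boundedVarpi ς N p) (boundedVarpi ς N g)]

theorem properSpace_boundedSeqs (h : IsRegularTower ς κ ε s) : ProperSpace (BoundedSeqs G) :=
  ⟨fun x r => (h.totallyBounded_closedBall (r + dist x 1)).subset
    (Metric.closedBall_subset_closedBall' le_rfl) |>.isCompact_of_isClosed
      Metric.isClosed_closedBall⟩

theorem eventually_upsilon_le (h : IsRegularTower ς κ ε s) [ContinuousMul (BoundedSeqs G)]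
    {η : ℝ} (hη : 0 < η) :
    ∀ᶠ N in atTop, Upsilon (G N) (SeparationQuotient (BoundedSeqs G)) ≤ η := by
  have _ := h.properSpace_boundedSeqs
  obtain ⟨ω, hω, equi⟩ := exists_dist_mul_right_lt (H := SeparationQuotient (BoundedSeqs G))
    (1 / η + 1) (show 0 < η / 4 by positivity)
  filter_upwards [h.eventually_add_tail_le (1 / η + 1),
    h.tail_tendsto.eventually_lt_const (show 0 < ω / 3 by positivity),
    h.tail_tendsto.eventually_lt_const (show 0 < η / 12 by positivity),
    h.tail_tendsto.eventually_lt_const (show (0 : ℝ) < 1 / 3 by norm_num)] with N hN hsω hsη hs₁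
  have hs := h.tail_pos N
  obtain ⟨κ', hκ'⟩ := exists_isLocAlmostIsoIso_of_almost_dense (η := η) (τ := 3 * s N)
    (R := 1 / η) (f := fun g : G N => SeparationQuotient.mk (boundedVarpi ς N g))
    (by linarith) (by linarith) (by linarith) (congrArg _ h.boundedVarpi_one)
    (fun a b c ha hb hc => by
      rw [← SeparationQuotient.mk_mul, SeparationQuotient.dist_mk]
      linarith [h.abs_dist_boundedVarpi_mul_sub_le (R := 1 / η + 1) (by linarith) ha hb hc])
    (fun z hz => by
      obtain ⟨x, rfl⟩ := SeparationQuotient.surjective_mk z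
      rw [← SeparationQuotient.mk_one, SeparationQuotient.dist_mk] at hz
      obtain ⟨g, hg, hgx⟩ := h.exists_dist_boundedVarpi_le (by linarith) hz
      exact ⟨g, by linarith, by rwa [SeparationQuotient.dist_mk]⟩)
    (fun a b c ha hb hc hab => (equi a b c ha hb hc (by linarith)).le)
  exact Upsilon_le hη hκ'

end IsRegularTower

/-- If `(G_n, δ_n)` is a sequence of proper metric monoids linked by
`(1/ε_n)`-local `ε_n`-almost isometric isomorphisms with `Σ ε_n < ∞`, and all the
sequences `ϖ_N(g)` for `g ∈ G_N[1/Σ_{n≥N} ε_n]` are regular, then there is a proper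
metric monoid `(G, δ)` with `lim_n Υ((G_n,δ_n),(G,δ)) = 0`. -/
theorem upsilon_cauchy_convergence
    (G : ℕ → Type) [∀ n, Monoid (G n)] [∀ n, MetricSpace (G n)]
    (h_left : ∀ n, ∀ g h k : G n, dist (g * h) (g * k) = dist h k)
    (h_cont : ∀ n, Continuous fun p : G n × G n => p.1 * p.2)
    (h_proper : ∀ n, ProperSpace (G n))
    (ε : ℕ → ℝ) (hε : ∀ n, 0 < ε n)
    (ς : ∀ n, G n → G (n + 1)) (κ : ∀ n, G (n + 1) → G n)
    (h_iso : ∀ n, IsLocAlmostIsoIso (ς n) (κ n) (ε n) (1 / ε n))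
    (h_sum : Summable ε)
    (h_reg : ∀ N : ℕ, ∀ g : G N,
      dist (1 : G N) g ≤ 1 / (∑' k : ℕ, ε (N + k)) → RegularSeq (varpi ς N g)) :
    ∃ (H : Type) (_ : Monoid H) (_ : MetricSpace H),
      (∀ g h k : H, dist (g * h) (g * k) = dist h k) ∧
      (Continuous fun p : H × H => p.1 * p.2) ∧
      ProperSpace H ∧
      Filter.Tendsto (fun n => Upsilon (G n) H) Filter.atTop (nhds 0) := by
  have _ : ∀ n, IsIsometricSMul (G n) (G n) := fun n =>
    ⟨fun g => Isometry.of_dist_eq (h_left n g)⟩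
  have h : IsRegularTower ς κ ε fun N => ∑' k : ℕ, ε (N + k) := by
    have hs : ∀ N, Summable fun k => ε (N + k) := fun N => by
      simpa only [add_comm] using (summable_nat_add_iff N).2 h_sum
    refine ⟨hε, h_iso, fun N => (hs N).tsum_pos (fun k => (hε _).le) 0 (hε _), fun N => ?_, ?_,
      h_reg⟩
    · rw [(hs N).tsum_eq_zero_add]
      simp only [add_zero, add_assoc, add_comm 1]
    · simpa only [add_comm] using tendsto_sum_nat_add ε
  have _ := h.continuousMul_boundedSeqs
  have _ := h.properSpace_boundedSeqs
  refine ⟨SeparationQuotient (BoundedSeqs G), inferInstance, inferInstance, dist_mul_left,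
    continuous_mul, inferInstance, Metric.tendsto_nhds.2 fun η hη => ?_⟩
  filter_upwards [h.eventually_upsilon_le (half_pos hη)] with N hN
  rw [Real.dist_0_eq_abs, abs_of_nonneg (Upsilon_nonneg _ _)]
  linarith
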